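/- The set ℕ of natural numbers is not a Bézivin set in ℚ: there is no M ≥ 0 and finitely generated subgroup G ≤ ℚ^× such that every natural number n ≥ 1 can be written as g_1 + ... + g_m with m ≤ M and g_i ∈ G. -/

import Mathlib

/-- Classes of exponent vectors modulo `e` separate elements of a finitely generated commutative
group up to `e`-th powers. -/
lemma exists_code_modulo_powers {A : Type*} [CommGroup A] (S : Finset A) (e : ℕ) :
    ∃ c : A → S → ZMod e, ∀ x ∈ Subgroup.closure (S : Set A), ∀ y ∈ Subgroup.closure (S : Set A),
      c x = c y → ∃ h ∈ Subgroup.closure (S : Set A), x = y * h ^ e := by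
  have hz (x : A) : ∃ z : S → ℤ, x ∈ Subgroup.closure (S : Set A) → ∏ a : S, (a : A) ^ z a = x := by
    by_cases hx : x ∈ Subgroup.closure (S : Set A)
    · rw [← Subtype.range_coe (s := (S : Set A))] at hx
      obtain ⟨z, rfl⟩ := Subgroup.exists_of_mem_closure_range _ _ hx
      exact ⟨z, fun _ ↦ rfl⟩
    · exact ⟨0, fun h ↦ (hx h).elim⟩
  choose z hz using hz
  refine ⟨fun x a ↦ (z x a : ZMod e), fun x hx y hy hxy ↦ ?_⟩
  have hdvd (a : S) : ∃ k : ℤ, z x a = z y a + e * k := by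
    obtain ⟨k, hk⟩ := (ZMod.intCast_eq_intCast_iff_dvd_sub _ _ _).1 (congrFun hxy a).symm
    exact ⟨k, by omega⟩
  choose k hk using hdvd
  refine ⟨∏ a : S, (a : A) ^ k a, Subgroup.prod_mem _ fun a _ ↦
    Subgroup.zpow_mem _ (Subgroup.subset_closure a.2) _, ?_⟩
  rw [← hz x hx, ← hz y hy, ← Finset.prod_pow, ← Finset.prod_mul_distrib]
  refine Finset.prod_congr rfl fun a _ ↦ ?_
  rw [hk, zpow_add, mul_comm (e : ℤ), zpow_mul, zpow_natCast]

lemma padicNorm_pow_sub_one_lt_one {p e : ℕ} [Fact p.Prime] (he : p - 1 ∣ e) {q : ℚ}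
    (hq : padicNorm p q = 1) : padicNorm p (q ^ e - 1) < 1 := by
  obtain ⟨k, rfl⟩ := he
  have hmul : padicNorm p q.num = padicNorm p (q.den : ℤ) := by
    have h := padicNorm.mul (p := p) q q.den
    rw [Rat.mul_den_eq_num, hq, one_mul] at h
    exact_mod_cast h
  have hden : ¬ (p : ℤ) ∣ (q.den : ℤ) := by
    intro hd
    have hn := hd
    rw [← padicNorm.int_lt_one_iff, ← hmul, padicNorm.int_lt_one_iff] at hn
    refine (Fact.out : p.Prime).one_lt.ne' (Nat.dvd_one.1 ?_)
    rw [← q.reduced]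
    exact Nat.dvd_gcd (Int.natCast_dvd.1 hn) (Int.natCast_dvd_natCast.1 hd)
  have hnum : ¬ (p : ℤ) ∣ q.num := by
    rwa [← padicNorm.int_lt_one_iff, hmul, padicNorm.int_lt_one_iff]
  have hfermat {a : ℤ} (ha : ¬ (p : ℤ) ∣ a) : (a : ZMod p) ^ ((p - 1) * k) = 1 := by
    rw [pow_mul, ZMod.pow_card_sub_one_eq_one, one_pow]
    rwa [Ne, ZMod.intCast_zmod_eq_zero_iff_dvd]
  have hdvd : (p : ℤ) ∣ q.num ^ ((p - 1) * k) - (q.den : ℤ) ^ ((p - 1) * k) := by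
    rw [← ZMod.intCast_zmod_eq_zero_iff_dvd, Int.cast_sub, Int.cast_pow, Int.cast_pow,
      hfermat hnum, hfermat hden, sub_self]
  have hdenpow : padicNorm p (((q.den : ℤ) ^ ((p - 1) * k) : ℤ) : ℚ) = 1 := by
    rw [padicNorm.int_eq_one_iff]
    exact fun h ↦ hden ((Nat.prime_iff_prime_int.1 Fact.out).dvd_of_dvd_pow h)
  have heq : q ^ ((p - 1) * k) - 1 =
      ((q.num ^ ((p - 1) * k) - (q.den : ℤ) ^ ((p - 1) * k) : ℤ) : ℚ) /
        (((q.den : ℤ) ^ ((p - 1) * k) : ℤ) : ℚ) := by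
    have hd : (q.den : ℚ) ≠ 0 := by exact_mod_cast q.den_nz
    push_cast
    rw [sub_div, div_self (pow_ne_zero _ hd), ← div_pow, Rat.num_div_den]
  rw [heq, padicNorm.div, hdenpow, div_one, padicNorm.int_lt_one_iff]
  exact hdvd

lemma padicNorm_eq_one_of_not_dvd {p : ℕ} [Fact p.Prime] {q : ℚ}
    (h : ¬ p ∣ q.num.natAbs * q.den) : padicNorm p q = 1 := by
  have h1 : padicNorm p q.num = 1 := by
    rw [padicNorm.int_eq_one_iff, Int.natCast_dvd]
    exact fun h' ↦ h (h'.mul_right _)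
  have h2 : padicNorm p q.den = 1 := by
    rw [padicNorm.nat_eq_one_iff]
    exact fun h' ↦ h (h'.mul_left _)
  rw [← Rat.num_div_den q, padicNorm.div, h1, h2, div_one]

lemma padicNorm_eq_one_of_mem_closure {p : ℕ} [Fact p.Prime] {S : Set ℚˣ}
    (hS : ∀ a ∈ S, padicNorm p (a : ℚ) = 1) {g : ℚˣ} (hg : g ∈ Subgroup.closure S) :
    padicNorm p (g : ℚ) = 1 := by
  induction hg using Subgroup.closure_induction with
  | mem x hx => exact hS x hx
  | one => simp
  | mul x y _ _ hx hy => rw [Units.val_mul, padicNorm.mul, hx, hy, one_mul]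
  | inv x _ hx =>
    rw [Units.val_inv_eq_inv_val, inv_eq_one_div, padicNorm.div, hx, padicNorm.one, div_one]

lemma exists_option_sum_eq {M : ℕ} {G : Subgroup ℚˣ} {x : ℚ}
    (h : ∃ (m : ℕ) (g : Fin m → ℚˣ), m ≤ M ∧ (∀ i, g i ∈ G) ∧ x = ∑ i, (g i : ℚ)) :
    ∃ w : Fin M → Option ℚˣ, (∀ i, ∀ g ∈ w i, g ∈ G) ∧ x = ∑ i, (w i).elim 0 (fun g ↦ (g : ℚ)) := by
  obtain ⟨m, g, hm, hg, rfl⟩ := h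
  obtain ⟨k, rfl⟩ := Nat.exists_eq_add_of_le hm
  refine ⟨Fin.append (fun i ↦ some (g i)) fun _ ↦ none, fun i ↦ ?_, ?_⟩
  · induction i using Fin.addCases with
    | left i => simpa using hg i
    | right i => simp
  · simp [Fin.sum_univ_add]

/-- If the naturals are sums of at most `M` elements of the group generated by `S`, then a product
of primes `p` prime to `S` with `p - 1 ∣ e` is polynomially bounded in `e`. -/
lemma prod_primes_le_of_sum_closure {M : ℕ} {S : Finset ℚˣ}
    (h : ∀ n : ℕ, 1 ≤ n → ∃ (m : ℕ) (g : Fin m → ℚˣ),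
      m ≤ M ∧ (∀ i, g i ∈ Subgroup.closure (S : Set ℚˣ)) ∧ (n : ℚ) = ∑ i, (g i : ℚ))
    {e : ℕ} (he : e ≠ 0) {P : Finset ℕ} (hP : ∀ p ∈ P, p.Prime) (hPe : ∀ p ∈ P, p - 1 ∣ e)
    (hPS : ∀ p ∈ P, ∀ a ∈ S, padicNorm p ((a : ℚˣ) : ℚ) = 1) :
    ∏ p ∈ P, p ≤ (e ^ S.card + 1) ^ M := by
  have : NeZero e := ⟨he⟩
  obtain ⟨c, hc⟩ := exists_code_modulo_powers S e
  have hw (n : ℕ) := exists_option_sum_eq (h (n + 1) n.succ_pos)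
  choose w hwG hw using hw
  have hinj : Function.Injective
      (fun (n : Fin (∏ p ∈ P, p)) (i : Fin M) ↦ (w n i).map c) := by
    intro n n' hnn
    have hdvd : ((∏ p ∈ P, p : ℕ) : ℤ) ∣ ((n : ℕ) : ℤ) - ((n' : ℕ) : ℤ) := by
      push_cast
      refine Finset.prod_dvd_of_coprime (fun p hp q hq hpq ↦ ?_) fun p hp ↦ ?_
      · exact Nat.isCoprime_iff_coprime.2 ((Nat.coprime_primes (hP p hp) (hP q hq)).2 hpq)
      · have : Fact p.Prime := ⟨hP p hp⟩
        have heq : ((((n : ℕ) : ℤ) - ((n' : ℕ) : ℤ) : ℤ) : ℚ) =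
            ∑ i, ((w n i).elim 0 (fun g ↦ (g : ℚ)) - (w n' i).elim 0 (fun g ↦ (g : ℚ))) := by
          rw [Finset.sum_sub_distrib, ← hw, ← hw]
          push_cast
          ring
        rw [← padicNorm.int_lt_one_iff, heq]
        refine padicNorm.sum_lt' (fun i _ ↦ ?_) one_pos
        have hi := congrFun hnn i
        dsimp only at hi
        have hx := hwG n i
        have hy := hwG n' i
        rcases hwn : w n i with _ | x <;> rcases hwn' : w n' i with _ | y <;>
          rw [hwn] at hi hx <;> rw [hwn'] at hi hy <;> simp at hi hx hy ⊢
        obtain ⟨u, hu, rfl⟩ := hc x hx y hy hi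
        have hnorm {g : ℚˣ} (hg : g ∈ Subgroup.closure (S : Set ℚˣ)) :=
          padicNorm_eq_one_of_mem_closure (hPS p hp) hg
        rw [Units.val_mul, Units.val_pow_eq_pow_val, ← mul_sub_one, padicNorm.mul, hnorm hy, one_mul]
        exact padicNorm_pow_sub_one_lt_one (hPe p hp) (hnorm hu)
    have := Int.eq_zero_of_abs_lt_dvd hdvd (by have := n.2; have := n'.2; rw [abs_lt]; omega)
    exact Fin.ext (by omega)
  simpa [ZMod.card] using Fintype.card_le_of_injective _ hinj

lemma log_div_rpow_le {s : ℝ} (hs : 1 < s) (n : ℕ) :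
    Real.log n / (n : ℝ) ^ s ≤ 2 / (s - 1) * (1 / (n : ℝ) ^ (1 + (s - 1) / 2)) := by
  have hδ : 0 < (s - 1) / 2 := by linarith
  rcases n.eq_zero_or_pos with rfl | hn
  · simp [Real.zero_rpow (show s ≠ 0 by linarith)]
    positivity
  have hn' : (0 : ℝ) < n := by exact_mod_cast hn
  calc Real.log n / (n : ℝ) ^ s
      ≤ ((n : ℝ) ^ ((s - 1) / 2) / ((s - 1) / 2)) / (n : ℝ) ^ s := by
        gcongr
        exact Real.log_le_rpow_div hn'.le hδ
    _ = _ := by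
        have h : (n : ℝ) ^ s = (n : ℝ) ^ (1 + (s - 1) / 2) * (n : ℝ) ^ ((s - 1) / 2) := by
          rw [← Real.rpow_add hn']
          ring_nf
        have := Real.rpow_pos_of_pos hn' ((s - 1) / 2)
        have := Real.rpow_pos_of_pos hn' (1 + (s - 1) / 2)
        have : s - 1 ≠ 0 := by linarith
        rw [h]
        field_simp

lemma summable_log_div_rpow {s : ℝ} (hs : 1 < s) :
    Summable fun n : ℕ ↦ Real.log n / (n : ℝ) ^ s :=
  ((Real.summable_one_div_nat_rpow.2 (by linarith)).mul_left _).of_nonneg_of_le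
    (fun n ↦ div_nonneg (Real.log_natCast_nonneg n) (by positivity)) (log_div_rpow_le hs)

lemma hasSum_dvd_one_div_rpow {s : ℝ} (hs : 1 < s) {b : ℕ} (hb : b ≠ 0) :
    HasSum (fun n : ℕ ↦ if b ∣ n then 1 / (n : ℝ) ^ s else 0)
      (1 / (b : ℝ) ^ s * ∑' n : ℕ, 1 / (n : ℝ) ^ s) := by
  rw [← (mul_right_injective₀ hb).hasSum_iff]
  · have heq : (fun n : ℕ ↦ if b ∣ n then 1 / (n : ℝ) ^ s else 0) ∘ (b * ·) =
        fun n : ℕ ↦ 1 / (b : ℝ) ^ s * (1 / (n : ℝ) ^ s) := by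
      ext n
      simp [Real.mul_rpow, mul_comm]
    rw [heq]
    exact (Real.summable_one_div_nat_rpow.2 hs).hasSum.mul_left _
  · intro n hn
    rw [if_neg]
    rintro ⟨k, rfl⟩
    exact hn ⟨k, rfl⟩

lemma exists_log_mean_bound :
    ∃ ε > 0, ∀ s : ℝ, 1 < s → s < 1 + ε → 0 < ∑' n : ℕ, 1 / (n : ℝ) ^ s ∧
      ∑' n : ℕ, Real.log n / (n : ℝ) ^ s ≤ 16 / (s - 1) * ∑' n : ℕ, 1 / (n : ℝ) ^ s := by
  have h := tendsto_sub_mul_tsum_nat_rpow.eventually (Ioo_mem_nhds (show (1 / 2 : ℝ) < 1 by norm_num)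
    (show (1 : ℝ) < 2 by norm_num))
  obtain ⟨u, hu, hsub⟩ := mem_nhdsGT_iff_exists_Ioo_subset.1 h
  refine ⟨u - 1, sub_pos.2 hu, fun s hs hsu ↦ ?_⟩
  have h1 : 0 < s - 1 := by linarith
  obtain ⟨hlow, -⟩ := hsub (show s ∈ Set.Ioo 1 u from ⟨hs, by linarith⟩)
  obtain ⟨-, hup⟩ := hsub (show 1 + (s - 1) / 2 ∈ Set.Ioo 1 u from ⟨by linarith, by linarith⟩)
  have hsum : ∑' n : ℕ, Real.log n / (n : ℝ) ^ s ≤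
      2 / (s - 1) * ∑' n : ℕ, 1 / (n : ℝ) ^ (1 + (s - 1) / 2) := by
    rw [← tsum_mul_left]
    exact (summable_log_div_rpow hs).tsum_le_tsum (log_div_rpow_le hs)
      ((Real.summable_one_div_nat_rpow.2 (by linarith)).mul_left _)
  set Z := ∑' n : ℕ, 1 / (n : ℝ) ^ s
  set Z' := ∑' n : ℕ, 1 / (n : ℝ) ^ (1 + (s - 1) / 2)
  have hZ : 1 / 2 / (s - 1) < Z := by rw [div_lt_iff₀ h1]; linarith
  have hZ' : Z' < 4 / (s - 1) := by rw [lt_div_iff₀ h1]; linarith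
  refine ⟨lt_trans (by positivity) hZ, hsum.trans ?_⟩
  calc 2 / (s - 1) * Z' ≤ 2 / (s - 1) * (4 / (s - 1)) := by gcongr
    _ = 16 / (s - 1) * (1 / 2 / (s - 1)) := by ring
    _ ≤ 16 / (s - 1) * Z := by gcongr

lemma exists_tsum_primes_modEq_one_lower_bound {d D : ℕ} (hd : d ≠ 0) (hD : D ≠ 0) :
    ∃ C : ℝ, ∀ s ∈ Set.Ioc (1 : ℝ) 2, (d.totient : ℝ)⁻¹ / (s - 1) - C ≤
      ∑' p : ℕ, if p.Prime ∧ ¬ p ∣ D ∧ d ∣ p - 1 then Real.log p / (p : ℝ) ^ s else 0 := by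
  have : NeZero d := ⟨hd⟩
  obtain ⟨C, hC⟩ := ArithmeticFunction.vonMangoldt.LSeries_residueClass_lower_bound
    (q := d) (a := 1) isUnit_one
  have hnp := ArithmeticFunction.vonMangoldt.summable_residueClass_non_primes_div (q := d) 1
  have hfin : Summable fun n : ℕ ↦ if n ∣ D then Real.log n else 0 := by
    refine summable_of_ne_finset_zero (s := D.divisors) fun n hn ↦ if_neg fun h ↦ hn ?_
    exact Nat.mem_divisors.2 ⟨h, hD⟩
  refine ⟨C + ((∑' n : ℕ, (if n.Prime then 0 else
    ArithmeticFunction.vonMangoldt.residueClass (1 : ZMod d) n) / n) +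
    ∑' n : ℕ, if n ∣ D then Real.log n else 0), fun s hs ↦ ?_⟩
  have hmain : Summable fun p : ℕ ↦
      if p.Prime ∧ ¬ p ∣ D ∧ d ∣ p - 1 then Real.log p / (p : ℝ) ^ s else 0 := by
    refine (summable_log_div_rpow hs.1).of_nonneg_of_le (fun p ↦ ?_) fun p ↦ ?_ <;>
      have := div_nonneg (Real.log_natCast_nonneg p) (Real.rpow_nonneg p.cast_nonneg s) <;>
      split_ifs <;> simp [this]
  have hres : Summable fun n : ℕ ↦
      ArithmeticFunction.vonMangoldt.residueClass (1 : ZMod d) n / (n : ℝ) ^ s := by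
    refine (summable_log_div_rpow hs.1).of_nonneg_of_le (fun n ↦ ?_) fun n ↦ ?_
    · exact div_nonneg (ArithmeticFunction.vonMangoldt.residueClass_nonneg _ _) (by positivity)
    · gcongr
      exact (ArithmeticFunction.vonMangoldt.residueClass_le _ _).trans
        ArithmeticFunction.vonMangoldt_le_log
  have hle := hres.tsum_le_tsum (fun n ↦ ?_) (hmain.add (hnp.add hfin))
  · rw [hmain.tsum_add (hnp.add hfin), hnp.tsum_add hfin] at hle
    linarith [hC hs]
  · have hlog := Real.log_natCast_nonneg n
    have hr := ArithmeticFunction.vonMangoldt.residueClass_nonneg (1 : ZMod d) n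
    rcases n.eq_zero_or_pos with rfl | hn
    · simp
    have hn1 : (1 : ℝ) ≤ n := by exact_mod_cast hn
    have hpow : (n : ℝ) ≤ (n : ℝ) ^ s := Real.self_le_rpow_of_one_le hn1 hs.1.le
    by_cases hp : n.Prime
    · have hiff : (n : ZMod d) = 1 ↔ d ∣ n - 1 := by
        rw [← ZMod.natCast_eq_zero_iff, Nat.cast_sub hn, Nat.cast_one, sub_eq_zero]
      have hnn : 0 ≤ Real.log n / (n : ℝ) ^ s := by positivity
      have hle : Real.log n / (n : ℝ) ^ s ≤ Real.log n := div_le_self hlog (hn1.trans hpow)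
      simp only [ArithmeticFunction.vonMangoldt.residueClass, Set.indicator_apply, Set.mem_ofPred_eq,
        hiff, ArithmeticFunction.vonMangoldt_apply_prime hp, hp, true_and, if_true, zero_div,
        zero_add]
      by_cases h1 : d ∣ n - 1 <;> by_cases h2 : n ∣ D <;> simp [h1, h2, hle, hlog]
    · simp only [hp, false_and, if_false, zero_add]
      refine le_add_of_le_of_nonneg ?_ (by split_ifs <;> simp [hlog])
      gcongr

lemma sum_log_div_rpow_le {D m : ℕ} (hm : m ≠ 0) {K C : ℝ}
    (H : ∀ e ≠ 0, ∀ P : Finset ℕ, (∀ p ∈ P, p.Prime ∧ ¬ p ∣ D ∧ p - 1 ∣ e) →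
      ∑ p ∈ P, Real.log p ≤ K * Real.log e + C)
    {s : ℝ} (hs : 1 < s) {P : Finset ℕ} (hP : ∀ p ∈ P, p.Prime ∧ ¬ p ∣ D) :
    (∑ p ∈ P, Real.log p * (1 / ((((p - 1) / (p - 1).gcd m : ℕ) : ℝ) ^ s))) *
        ∑' n : ℕ, 1 / (n : ℝ) ^ s ≤
      K * (∑' n : ℕ, Real.log n / (n : ℝ) ^ s) +
        (K * Real.log m + C) * ∑' n : ℕ, 1 / (n : ℝ) ^ s := by
  have hb {p : ℕ} (hp : p ∈ P) : (p - 1) / (p - 1).gcd m ≠ 0 := by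
    have h1 := (hP p hp).1.two_le
    exact (Nat.div_gcd_pos_of_pos_left m (show 0 < p - 1 by omega)).ne'
  have hl := hasSum_sum fun p hp ↦ (hasSum_dvd_one_div_rpow hs (hb hp)).mul_left (Real.log p)
  have hr := ((summable_log_div_rpow hs).hasSum.mul_left K).add
    ((Real.summable_one_div_nat_rpow.2 hs).hasSum.mul_left (K * Real.log m + C))
  rw [Finset.sum_mul]
  simp only [mul_assoc] at hl ⊢
  refine hasSum_le (fun n ↦ ?_) hl hr
  rcases eq_or_ne n 0 with rfl | hn
  · simp [Real.zero_rpow (show s ≠ 0 by linarith)]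
  have hH := H (m * n) (mul_ne_zero hm hn) {p ∈ P | (p - 1) / (p - 1).gcd m ∣ n} fun p hp ↦ by
    rw [Finset.mem_filter] at hp
    refine ⟨(hP p hp.1).1, (hP p hp.1).2, ?_⟩
    rw [← Nat.mul_div_cancel' (Nat.gcd_dvd_left (p - 1) m)]
    exact mul_dvd_mul (Nat.gcd_dvd_right _ _) hp.2
  rw [Nat.cast_mul, Real.log_mul (by exact_mod_cast hm) (by exact_mod_cast hn),
    Finset.sum_filter] at hH
  have hpos : 0 ≤ 1 / (n : ℝ) ^ s := by positivity
  calc _ = (∑ p ∈ P, if (p - 1) / (p - 1).gcd m ∣ n then Real.log p else 0) *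
        (1 / (n : ℝ) ^ s) := by simp [Finset.sum_mul, ite_mul]
    _ ≤ _ := mul_le_mul_of_nonneg_right hH hpos
    _ = _ := by ring

lemma sum_totient_mul_le_one_div_rpow {p m : ℕ} (hp : p.Prime) {s : ℝ} (hs : 1 ≤ s) :
    (∑ d ∈ m.divisors, if d ∣ p - 1 then (d.totient : ℝ) else 0) / (p : ℝ) ^ s ≤
      1 / (((p - 1) / (p - 1).gcd m : ℕ) : ℝ) ^ s := by
  have hp1 : 0 < p - 1 := by have := hp.two_le; omega
  rcases eq_or_ne m 0 with rfl | hm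
  · simp
    positivity
  have hsum : (∑ d ∈ m.divisors, if d ∣ p - 1 then (d.totient : ℝ) else 0) =
      ((p - 1).gcd m : ℝ) := by
    rw [← Finset.sum_filter, ← Nat.sum_totient ((p - 1).gcd m), Nat.cast_sum]
    refine Finset.sum_congr ?_ fun _ _ ↦ rfl
    ext d
    simp [Nat.dvd_gcd_iff, hm, hp1.ne', and_comm]
  have hg : 0 < (p - 1).gcd m := Nat.gcd_pos_of_pos_left _ hp1
  have hb : 0 < (p - 1) / (p - 1).gcd m := Nat.div_gcd_pos_of_pos_left m hp1
  have hprod : ((p - 1).gcd m : ℝ) * ((p - 1) / (p - 1).gcd m : ℕ) ≤ p := by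
    rw [← Nat.cast_mul, Nat.mul_div_cancel' (Nat.gcd_dvd_left _ _)]
    exact_mod_cast Nat.sub_le p 1
  have hp0 : (0 : ℝ) < p := by exact_mod_cast hp.pos
  rw [hsum, div_le_div_iff₀ (by positivity) (by positivity), one_mul]
  calc _ ≤ ((p - 1).gcd m : ℝ) ^ s * (((p - 1) / (p - 1).gcd m : ℕ) : ℝ) ^ s := by
        gcongr
        exact Real.self_le_rpow_of_one_le (by exact_mod_cast hg) hs
    _ = (((p - 1).gcd m : ℝ) * ((p - 1) / (p - 1).gcd m : ℕ)) ^ s :=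
        (Real.mul_rpow (by positivity) (by positivity)).symm
    _ ≤ _ := by gcongr

/-- Products of primes `p ∤ D` with `p - 1 ∣ e` are not polynomially bounded in `e`. -/
theorem not_sum_log_primes_le {D : ℕ} (hD : D ≠ 0) {K C : ℝ} (hK : 0 ≤ K) :
    ¬ ∀ e ≠ 0, ∀ P : Finset ℕ, (∀ p ∈ P, p.Prime ∧ ¬ p ∣ D ∧ p - 1 ∣ e) →
      ∑ p ∈ P, Real.log p ≤ K * Real.log e + C := by
  intro H
  obtain ⟨t, ht⟩ := exists_nat_gt (16 * K)
  set m := 2 ^ t with hm_def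
  have hm : m ≠ 0 := by positivity
  have hd0 {d : ℕ} (hd : d ∈ m.divisors) : d ≠ 0 := (Nat.pos_of_mem_divisors hd).ne'
  have hcard : m.divisors.card = t + 1 := by
    rw [hm_def, Nat.divisors_prime_pow Nat.prime_two]
    simp
  have hlow (d : ℕ) : ∃ B : ℝ, d ≠ 0 → ∀ s ∈ Set.Ioc (1 : ℝ) 2, (d.totient : ℝ)⁻¹ / (s - 1) - B ≤
      ∑' p : ℕ, if p.Prime ∧ ¬ p ∣ D ∧ d ∣ p - 1 then Real.log p / (p : ℝ) ^ s else 0 := by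
    by_cases hd : d = 0
    · exact ⟨0, fun h ↦ (h hd).elim⟩
    · obtain ⟨B, hB⟩ := exists_tsum_primes_modEq_one_lower_bound hd hD
      exact ⟨B, fun _ ↦ hB⟩
  choose B hB using hlow
  obtain ⟨ε, hε, hmean⟩ := exists_log_mean_bound
  have key (s : ℝ) (hs : 1 < s) (hsε : s < 1 + ε) (hs2 : s ≤ 2) :
      (t + 1) / (s - 1) - ∑ d ∈ m.divisors, d.totient * B d ≤
        16 * K / (s - 1) + (K * Real.log m + C) := by
    obtain ⟨hZ, hlogZ⟩ := hmean s hs hsε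
    have hsummable (d : ℕ) : Summable fun p : ℕ ↦
        if p.Prime ∧ ¬ p ∣ D ∧ d ∣ p - 1 then Real.log p / (p : ℝ) ^ s else 0 := by
      refine (summable_log_div_rpow hs).of_nonneg_of_le (fun p ↦ ?_) fun p ↦ ?_ <;>
        have := div_nonneg (Real.log_natCast_nonneg p) (Real.rpow_nonneg p.cast_nonneg s) <;>
        split_ifs <;> simp [this]
    calc _ = ∑ d ∈ m.divisors, (d.totient : ℝ) * ((d.totient : ℝ)⁻¹ / (s - 1) - B d) := by
          simp only [mul_sub, Finset.sum_sub_distrib]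
          congr 1
          rw [Finset.sum_congr rfl (g := fun _ ↦ 1 / (s - 1)), Finset.sum_const, hcard]
          · rw [nsmul_eq_mul]
            push_cast
            ring
          · intro d hd
            have : (d.totient : ℝ) ≠ 0 := by
              exact_mod_cast (Nat.totient_pos.2 (Nat.pos_of_mem_divisors hd)).ne'
            field_simp
      _ ≤ ∑ d ∈ m.divisors, (d.totient : ℝ) *
            ∑' p : ℕ, if p.Prime ∧ ¬ p ∣ D ∧ d ∣ p - 1 then Real.log p / (p : ℝ) ^ s else 0 := by
          gcongr with d hd
          exact hB d (hd0 hd) s ⟨hs, hs2⟩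
      _ = ∑' p : ℕ, ∑ d ∈ m.divisors, (d.totient : ℝ) *
            if p.Prime ∧ ¬ p ∣ D ∧ d ∣ p - 1 then Real.log p / (p : ℝ) ^ s else 0 := by
          rw [Summable.tsum_finsetSum fun d _ ↦ (hsummable d).mul_left _]
          simp only [tsum_mul_left]
      _ ≤ _ := by
          refine Summable.tsum_le_of_sum_le
            (summable_sum fun d _ ↦ (hsummable d).mul_left _) fun P ↦ ?_
          have hbound := sum_log_div_rpow_le hm H hs (P := {p ∈ P | p.Prime ∧ ¬ p ∣ D})
            fun p hp ↦ (Finset.mem_filter.1 hp).2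
          calc _ = ∑ p ∈ P with p.Prime ∧ ¬ p ∣ D, Real.log p *
                ((∑ d ∈ m.divisors, if d ∣ p - 1 then (d.totient : ℝ) else 0) / (p : ℝ) ^ s) := by
                rw [Finset.sum_filter]
                refine Finset.sum_congr rfl fun p _ ↦ ?_
                split_ifs with hp
                · rw [Finset.sum_div, Finset.mul_sum]
                  refine Finset.sum_congr rfl fun d _ ↦ ?_
                  by_cases hd : d ∣ p - 1 <;> simp [hp, hd]
                  ring
                · refine Finset.sum_eq_zero fun d _ ↦ ?_
                  rw [if_neg fun h ↦ hp ⟨h.1, h.2.1⟩, mul_zero]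
            _ ≤ ∑ p ∈ P with p.Prime ∧ ¬ p ∣ D, Real.log p *
                (1 / ((((p - 1) / (p - 1).gcd m : ℕ) : ℝ) ^ s)) := by
                refine Finset.sum_le_sum fun p hp ↦
                  mul_le_mul_of_nonneg_left ?_ (Real.log_natCast_nonneg p)
                exact sum_totient_mul_le_one_div_rpow (Finset.mem_filter.1 hp).2.1 hs.le
            _ ≤ _ := by
                refine le_of_mul_le_mul_right (hbound.trans ?_) hZ
                calc _ ≤ K * (16 / (s - 1) * ∑' n : ℕ, 1 / (n : ℝ) ^ s) +
                      (K * Real.log m + C) * ∑' n : ℕ, 1 / (n : ℝ) ^ s := by gcongr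
                  _ = _ := by ring
  set A := ∑ d ∈ m.divisors, d.totient * B d + (K * Real.log m + C)
  obtain ⟨δ, hδ, hδA⟩ : ∃ δ > 0, δ < ε ∧ δ ≤ 1 ∧ δ * A < 1 := by
    refine ⟨min (ε / 2) (min 1 (1 / (2 * (|A| + 1)))), by positivity, ?_, ?_, ?_⟩
    · exact (min_le_left _ _).trans_lt (by linarith)
    · exact (min_le_right _ _).trans (min_le_left _ _)
    · have h : min (ε / 2) (min 1 (1 / (2 * (|A| + 1)))) ≤ 1 / (2 * (|A| + 1)) :=
        (min_le_right _ _).trans (min_le_right _ _)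
      calc _ ≤ min (ε / 2) (min 1 (1 / (2 * (|A| + 1)))) * (|A| + 1) := by
            gcongr
            linarith [le_abs_self A]
        _ ≤ 1 / (2 * (|A| + 1)) * (|A| + 1) := by gcongr
        _ < 1 := by field_simp; norm_num
  have hkey := key (1 + δ) (by linarith) (by linarith) (by linarith)
  rw [add_sub_cancel_left, sub_le_iff_le_add] at hkey
  have hdiv : (t + 1 - 16 * K) / δ ≤ A := by
    rw [sub_div]
    linarith
  rw [div_le_iff₀ hδ] at hdiv
  linarith

theorem nat_not_bezivin :
    ¬ ∃ (M : ℕ) (G : Subgroup ℚˣ), Group.FG G ∧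
      ∀ n : ℕ, 1 ≤ n → ∃ (m : ℕ) (g : Fin m → ℚˣ),
        m ≤ M ∧ (∀ i, g i ∈ G) ∧ (n : ℚ) = ∑ i, (g i : ℚ) := by
  rintro ⟨M, G, hG, h⟩
  obtain ⟨S, rfl⟩ := (Group.fg_iff_subgroup_fg G).1 hG
  have hD : ∏ a ∈ S, (a : ℚ).num.natAbs * (a : ℚ).den ≠ 0 :=
    Finset.prod_ne_zero_iff.2 fun a _ ↦ by simp
  refine not_sum_log_primes_le hD (K := M * S.card) (C := M * Real.log 2) (by positivity)
    fun e he P hP ↦ ?_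
  have hbound := prod_primes_le_of_sum_closure h he (fun p hp ↦ (hP p hp).1)
    (fun p hp ↦ (hP p hp).2.2) fun p hp a ha ↦ by
      have : Fact p.Prime := ⟨(hP p hp).1⟩
      exact padicNorm_eq_one_of_not_dvd fun hdvd ↦
        (hP p hp).2.1 (hdvd.trans (Finset.dvd_prod_of_mem _ ha))
  have he' : (0 : ℝ) < e := by exact_mod_cast Nat.pos_of_ne_zero he
  have hle : ((∏ p ∈ P, p : ℕ) : ℝ) ≤ (2 * (e : ℝ) ^ S.card) ^ M := by
    have hone : 1 ≤ e ^ S.card := Nat.one_le_pow _ _ (Nat.pos_of_ne_zero he)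
    exact_mod_cast hbound.trans (Nat.pow_le_pow_left (by omega) M)
  have hpos : (0 : ℝ) < (∏ p ∈ P, p : ℕ) := by
    exact_mod_cast Finset.prod_pos fun p hp ↦ (hP p hp).1.pos
  have hlog := Real.log_le_log hpos hle
  rw [Nat.cast_prod, Real.log_prod fun p hp ↦ by exact_mod_cast (hP p hp).1.ne_zero, Real.log_pow,
    Real.log_mul two_ne_zero (pow_pos he' _).ne', Real.log_pow] at hlog
  linarith
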